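/- arXiv:2009.11634 — 2 statements merged into one kernel-verified Lean document; each statement's English description precedes it below -/
import Mathlib

section
/- Let f ∈ ℂ[X₀,X₁,X₂,X₃] be weighted homogeneous of degree 10 with respect to the weights (1,1,2,5), and suppose every monomial in the support of f has even exponent at X₀ and even exponent at X₁. Then there exist a constant c ∈ ℂ and a polynomial g ∈ ℂ[U,V,W] that is homogeneous of degree 5 (for the ordinary grading) such that f = c·X₃² + g(X₀², X₁², X₂). -/
open MvPolynomial

/-- A monomial in four variables is the product of powers of those variables. -/
theorem MvPolynomial.monomial_fin_four {R : Type*} [CommSemiring R] (m : Fin 4 →₀ ℕ) (a : R) :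
    monomial m a = C a * (X 0 ^ m 0 * X 1 ^ m 1 * X 2 ^ m 2 * X 3 ^ m 3) := by
  rw [monomial_eq, Finsupp.prod_fintype _ _ (fun _ => pow_zero _), Fin.prod_univ_four]

/-- The decomposition of a weighted homogeneous polynomial, for a single monomial. -/
theorem exists_monomial_eq_sq_add_aeval {R : Type*} [CommSemiring R] (m : Fin 4 →₀ ℕ) (a : R)
    (hw : m 0 + m 1 + 2 * m 2 + 5 * m 3 = 10) (h₀ : Even (m 0)) (h₁ : Even (m 1)) :
    ∃ (c : R) (g : MvPolynomial (Fin 3) R), g.IsHomogeneous 5 ∧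
      monomial m a = C c * X 3 ^ 2 + aeval ![X 0 ^ 2, X 1 ^ 2, X 2] g := by
  obtain ⟨i, hi⟩ := h₀
  obtain ⟨j, hj⟩ := h₁
  rw [monomial_fin_four]
  obtain h₃ | h₃ : m 3 = 0 ∨ m 3 = 2 := by omega
  · refine ⟨0, C a * (X 0 ^ i * X 1 ^ j * X 2 ^ m 2), ?_, ?_⟩
    · have h := (((isHomogeneous_X_pow (R := R) (0 : Fin 3) i).mul
        (isHomogeneous_X_pow 1 j)).mul (isHomogeneous_X_pow 2 (m 2))).C_mul a
      rwa [show i + j + m 2 = 5 by omega] at h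
    · simp [h₃, hi, hj, ← pow_mul, two_mul, algebraMap_eq]
  · refine ⟨a, 0, isHomogeneous_zero _ _ _, ?_⟩
    simp [h₃, show m 0 = 0 by omega, show m 1 = 0 by omega, show m 2 = 0 by omega]

/-- Let `f ∈ ℂ[X₀,X₁,X₂,X₃]` be weighted homogeneous of degree `10` with respect to the
weights `(1,1,2,5)`, and suppose every monomial in the support of `f` has even exponent at
`X₀` and even exponent at `X₁`. Then there exist a constant `c ∈ ℂ` and a polynomial
`g ∈ ℂ[U,V,W]`, homogeneous of degree `5` for the ordinary grading, such that
`f = c·X₃² + g(X₀², X₁², X₂)`. -/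
theorem stmt6 (f : MvPolynomial (Fin 4) ℂ)
    (hf : f.IsWeightedHomogeneous ![1, 1, 2, 5] 10)
    (heven : ∀ m ∈ f.support, Even (m 0) ∧ Even (m 1)) :
    ∃ (c : ℂ) (g : MvPolynomial (Fin 3) ℂ), g.IsHomogeneous 5 ∧
      f = C c * X 3 ^ 2 + aeval ![X 0 ^ 2, X 1 ^ 2, X 2] g := by
  rw [f.as_sum]
  refine Finset.sum_induction _ (fun p => ∃ (c : ℂ) (g : MvPolynomial (Fin 3) ℂ),
    g.IsHomogeneous 5 ∧ p = C c * X 3 ^ 2 + aeval ![X 0 ^ 2, X 1 ^ 2, X 2] g) ?_ ?_ ?_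
  · rintro _ _ ⟨c, g, hg, rfl⟩ ⟨d, k, hk, rfl⟩
    refine ⟨c + d, g + k, hg.add hk, ?_⟩
    rw [C_add, map_add]
    ring
  · exact ⟨0, 0, isHomogeneous_zero _ _ _, by simp⟩
  · intro m hm
    have hw := hf (mem_support_iff.mp hm)
    rw [Finsupp.weight_apply, Finsupp.sum_fintype _ _ (by simp),
      Fin.sum_univ_four] at hw
    simp only [smul_eq_mul, Matrix.cons_val] at hw
    exact exists_monomial_eq_sq_add_aeval m _ (by omega) (heven m hm).1 (heven m hm).2
end

section
/- Let f ∈ ℂ[X₀,X₁,X₂,X₃] be weighted homogeneous of degree 10 with respect to the weights (1,1,2,5), with every monomial in its support having even exponent at X₀ and even exponent at X₁. If f(0,0,1,0) = 0, then all four partial derivatives ∂f/∂X₀, ∂f/∂X₁, ∂f/∂X₂, ∂f/∂X₃ vanish at the point (0,0,1,0). -/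
open MvPolynomial

/-- Let `f ∈ ℂ[X₀,X₁,X₂,X₃]` be weighted homogeneous of degree `10` with respect to the
weights `(1,1,2,5)`, with every monomial in its support having even exponent at `X₀` and
even exponent at `X₁`. If `f(0,0,1,0) = 0`, then all four partial derivatives of `f`
vanish at the point `(0,0,1,0)`. -/
theorem stmt9 (f : MvPolynomial (Fin 4) ℂ)
    (hf : f.IsWeightedHomogeneous ![1, 1, 2, 5] 10)
    (heven : ∀ m ∈ f.support, Even (m 0) ∧ Even (m 1))
    (hzero : eval ![0, 0, 1, 0] f = 0) :
    ∀ i : Fin 4, eval ![0, 0, 1, 0] (pderiv i f) = 0 := by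
  have hdeg : ∀ m ∈ f.support, m 0 + m 1 + m 2 * 2 + m 3 * 5 = 10 := by
    intro m hm
    have h := hf (mem_support_iff.mp hm)
    simpa [Finsupp.weight_apply, Finsupp.sum_fintype, Fin.sum_univ_four] using h
  have hcoeff : coeff (Finsupp.single 2 5) f = 0 := by
    rw [eval_eq', Finset.sum_eq_single (Finsupp.single 2 5)] at hzero
    · simpa [Fin.prod_univ_four] using hzero
    · intro m hm hne
      have hd := hdeg m hm
      have hpos : m 0 ≠ 0 ∨ m 1 ≠ 0 ∨ m 3 ≠ 0 := by
        by_contra! h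
        obtain ⟨h0, h1, h3⟩ := h
        apply hne
        ext j
        fin_cases j <;> simp [h0, h1, h3]
        omega
      rcases hpos with h | h | h <;> simp [Fin.prod_univ_four, h]
    · intro h
      simp [notMem_support_iff.mp h]
  have hpos : ∀ m ∈ f.support, 2 ≤ m 0 ∨ 2 ≤ m 1 ∨ 2 ≤ m 3 := by
    intro m hm
    have hd := hdeg m hm
    obtain ⟨⟨a, ha⟩, ⟨b, hb⟩⟩ := heven m hm
    by_contra! h
    have hm' : m = Finsupp.single 2 5 := by
      ext j
      fin_cases j <;> simp <;> omega
    exact mem_support_iff.mp hm (hm' ▸ hcoeff)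
  intro i
  rw [f.as_sum, map_sum, map_sum]
  refine Finset.sum_eq_zero fun m hm => ?_
  rw [pderiv_monomial, eval_monomial, Finsupp.prod_fintype _ _ (by simp), Fin.prod_univ_four]
  have hsub (j : Fin 4) (hj : 2 ≤ m j) : m j - Finsupp.single i 1 j ≠ 0 := by
    have : Finsupp.single i 1 j ≤ 1 := by
      rw [Finsupp.single_apply]
      split_ifs <;> simp
    omega
  rcases hpos m hm with h | h | h <;> simp [hsub _ h]
end
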